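/- The stabilizer of the associative three-form lies in SO(7): let ω be the three-form on V = Fin 7 → ℝ given by ω = e^{123} + e^{365} + e^{541} + e^{264} + e^{176} + e^{572} + e^{374} (the associative three-form of the octonions). If g : V ≃ₗ[ℝ] V is a linear automorphism with ω(g u, g v, g w) = ω(u, v, w) for all u, v, w ∈ V, then g preserves the Euclidean inner product, i.e. ∑ᵢ (g u)ᵢ (g v)ᵢ = ∑ᵢ uᵢ vᵢ for all u, v ∈ V, and LinearMap.det (g : V →ₗ[ℝ] V) = 1. -/

import Mathlib

noncomputable section

/-- `eDet i j k u v w` is the three-form `e^{ijk}` evaluated at `(u, v, w)`: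
the determinant of the 3×3 matrix with rows `(uᵢ, vᵢ, wᵢ)`, `(uⱼ, vⱼ, wⱼ)`, `(uₖ, vₖ, wₖ)`. -/
def eDet {n : ℕ} (i j k : Fin n) (u v w : Fin n → ℝ) : ℝ :=
  Matrix.det !![u i, v i, w i; u j, v j, w j; u k, v k, w k]

/-- The associative three-form of the octonions,
`ω = e^{123} + e^{365} + e^{541} + e^{264} + e^{176} + e^{572} + e^{374}`
(indices `1,…,7` rendered as `0,…,6` in `Fin 7`). -/
def assocForm (u v w : Fin 7 → ℝ) : ℝ :=
  eDet 0 1 2 u v w + eDet 2 5 4 u v w + eDet 4 3 0 u v w + eDet 1 5 3 u v w +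
    eDet 0 6 5 u v w + eDet 4 6 1 u v w + eDet 2 6 3 u v w


/-- Pfaffian of the 4×4 block of `P` on indices `a b c d`. -/
def pf4 (P : Fin 7 → Fin 7 → ℝ) (a b c d : Fin 7) : ℝ :=
  P a b * P c d - P a c * P b d + P a d * P b c

/-- The coefficient of the seven-form `P ∧ P ∧ W` (up to a constant). -/
def topF (P : Fin 7 → Fin 7 → ℝ) (W : Fin 7 → Fin 7 → Fin 7 → ℝ) : ℝ :=
    W 0 1 2 * pf4 P 3 4 5 6 - W 0 1 3 * pf4 P 2 4 5 6 + W 0 1 4 * pf4 P 2 3 5 6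
    - W 0 1 5 * pf4 P 2 3 4 6 + W 0 1 6 * pf4 P 2 3 4 5 + W 0 2 3 * pf4 P 1 4 5 6
    - W 0 2 4 * pf4 P 1 3 5 6 + W 0 2 5 * pf4 P 1 3 4 6 - W 0 2 6 * pf4 P 1 3 4 5
    + W 0 3 4 * pf4 P 1 2 5 6 - W 0 3 5 * pf4 P 1 2 4 6 + W 0 3 6 * pf4 P 1 2 4 5
    + W 0 4 5 * pf4 P 1 2 3 6 - W 0 4 6 * pf4 P 1 2 3 5 + W 0 5 6 * pf4 P 1 2 3 4
    - W 1 2 3 * pf4 P 0 4 5 6 + W 1 2 4 * pf4 P 0 3 5 6 - W 1 2 5 * pf4 P 0 3 4 6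
    + W 1 2 6 * pf4 P 0 3 4 5 - W 1 3 4 * pf4 P 0 2 5 6 + W 1 3 5 * pf4 P 0 2 4 6
    - W 1 3 6 * pf4 P 0 2 4 5 - W 1 4 5 * pf4 P 0 2 3 6 + W 1 4 6 * pf4 P 0 2 3 5
    - W 1 5 6 * pf4 P 0 2 3 4 + W 2 3 4 * pf4 P 0 1 5 6 - W 2 3 5 * pf4 P 0 1 4 6
    + W 2 3 6 * pf4 P 0 1 4 5 + W 2 4 5 * pf4 P 0 1 3 6 - W 2 4 6 * pf4 P 0 1 3 5
    + W 2 5 6 * pf4 P 0 1 3 4 - W 3 4 5 * pf4 P 0 1 2 6 + W 3 4 6 * pf4 P 0 1 2 5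
    - W 3 5 6 * pf4 P 0 1 2 4 + W 4 5 6 * pf4 P 0 1 2 3

lemma assoc_add (u v w w' : Fin 7 → ℝ) :
    assocForm u v (w + w') = assocForm u v w + assocForm u v w' := by
  simp [assocForm, eDet, Matrix.det_fin_three]; ring

lemma assoc_smul (u v w : Fin 7 → ℝ) (c : ℝ) :
    assocForm u v (c • w) = c * assocForm u v w := by
  simp [assocForm, eDet, Matrix.det_fin_three]; ring

lemma assoc_swap (u v w : Fin 7 → ℝ) : assocForm u v w = - assocForm v u w := by
  simp [assocForm, eDet, Matrix.det_fin_three]; ring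

lemma assoc_swap' (u v w : Fin 7 → ℝ) : assocForm u v w = - assocForm u w v := by
  simp [assocForm, eDet, Matrix.det_fin_three]; ring

lemma assoc_add2 (u v w w' : Fin 7 → ℝ) :
    assocForm u (w + w') v = assocForm u w v + assocForm u w' v := by
  simp [assocForm, eDet, Matrix.det_fin_three]; ring

lemma assoc_smul2 (u v w : Fin 7 → ℝ) (c : ℝ) :
    assocForm u (c • w) v = c * assocForm u w v := by
  simp [assocForm, eDet, Matrix.det_fin_three]; ring

lemma assoc_add1 (u v w w' : Fin 7 → ℝ) :
    assocForm (w + w') u v = assocForm w u v + assocForm w' u v := by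
  simp [assocForm, eDet, Matrix.det_fin_three]; ring

lemma assoc_smul1 (u v w : Fin 7 → ℝ) (c : ℝ) :
    assocForm (c • w) u v = c * assocForm w u v := by
  simp [assocForm, eDet, Matrix.det_fin_three]; ring

lemma topF_zero (P : Fin 7 → Fin 7 → ℝ) (W : Fin 7 → Fin 7 → Fin 7 → ℝ)
    (hP : ∀ i j, P i j = - P j i) (h1 : ∀ i j k, W i j k = - W j i k)
    (h2 : ∀ i j k, W i j k = - W i k j) (a b : Fin 7) (hab : a < b)
    (eP : ∀ j, P b j = P a j) (eW : ∀ j k, W b j k = W a j k) : topF P W = 0 := by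
  have hP0 : ∀ i, P i i = 0 := fun i => by linarith [hP i i]
  have h10 : ∀ i k, W i i k = 0 := fun i k => by linarith [h1 i i k]
  have h20 : ∀ i k, W i k k = 0 := fun i k => by linarith [h2 i k k]
  have eP' : ∀ j, P j b = P j a := fun j => by rw [hP j b, hP j a, eP]
  have eW' : ∀ j k, W j b k = W j a k := fun j k => by rw [h1 j b, h1 j a, eW]
  have eW'' : ∀ j k, W j k b = W j k a := fun j k => by rw [h2 j k b, h2 j k a, eW']
  have hP' : ∀ i j, j < i → P i j = - P j i := fun i j _ => hP i j
  have h1' : ∀ i j k, j < i → W i j k = - W j i k := fun i j k _ => h1 i j k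
  have h2' : ∀ i j k, k < j → W i j k = - W i k j := fun i j k _ => h2 i j k
  clear hP h1 h2
  unfold topF pf4
  fin_cases a <;> fin_cases b <;> first
    | (exfalso; revert hab; decide)
    | (clear hab
       simp only [Fin.zero_eta, Fin.mk_one, Fin.reduceFinMk] at eP eW eP' eW' eW''
       simp only [eP, eW, eP', eW', eW'', hP0, h10, h20]
       try simp (discharger := decide) only [hP', h1', h2', hP0, h10, h20]
       ring)

/-- `topF` on seven vectors, for the two-form `assocForm u`. -/
def topU (u : Fin 7 → ℝ) (x : Fin 7 → Fin 7 → ℝ) : ℝ :=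
  topF (fun i j => assocForm u (x i) (x j)) (fun i j k => assocForm (x i) (x j) (x k))

lemma topU_zero (u : Fin 7 → ℝ) (x : Fin 7 → Fin 7 → ℝ) (a b : Fin 7) (hab : a < b)
    (h : x a = x b) : topU u x = 0 := by
  apply topF_zero _ _ _ _ _ a b hab
  · intro j; simp only [h]
  · intro j k; simp only [h]
  · intro i j; exact assoc_swap' _ _ _
  · intro i j k; exact assoc_swap _ _ _
  · intro i j k; exact assoc_swap' _ _ _

lemma topU_std (u : Fin 7 → ℝ) :
    topU u (fun i => Pi.single i 1) = 3 * ∑ i, u i * u i := by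
  simp [topU, topF, pf4, assocForm, eDet, Matrix.det_fin_three, Pi.single_apply,
    Fin.sum_univ_succ]
  ring

lemma topU_add (u : Fin 7 → ℝ) (m : Fin 7 → Fin 7 → ℝ) (i : Fin 7) (x y : Fin 7 → ℝ) :
    topU u (Function.update m i (x + y)) =
      topU u (Function.update m i x) + topU u (Function.update m i y) := by
  fin_cases i <;>
  · simp [topU, topF, pf4, Function.update_apply, assoc_add, assoc_add1, assoc_add2]
    ring

lemma topU_smul (u : Fin 7 → ℝ) (m : Fin 7 → Fin 7 → ℝ) (i : Fin 7) (c : ℝ) (x : Fin 7 → ℝ) :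
    topU u (Function.update m i (c • x)) = c * topU u (Function.update m i x) := by
  fin_cases i <;>
  · simp [topU, topF, pf4, Function.update_apply, assoc_smul, assoc_smul1, assoc_smul2]
    ring

/-- `topU` as an alternating map. -/
def topA (u : Fin 7 → ℝ) : (Fin 7 → ℝ) [⋀^Fin 7]→ₗ[ℝ] ℝ where
  toFun := topU u
  map_update_add' := by
    intro inst m i x y
    rw [Subsingleton.elim inst (instDecidableEqFin 7)]
    exact topU_add u m i x y
  map_update_smul' := by
    intro inst m i c x
    rw [Subsingleton.elim inst (instDecidableEqFin 7)]
    exact topU_smul u m i c x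
  map_eq_zero_of_eq' := by
    intro v i j h hij
    rcases lt_or_gt_of_ne hij with h' | h'
    · exact topU_zero u v i j h' h
    · exact topU_zero u v j i h' h.symm

theorem stabilizer_assocForm_in_SO7
    (g : (Fin 7 → ℝ) ≃ₗ[ℝ] (Fin 7 → ℝ))
    (hg : ∀ u v w : Fin 7 → ℝ, assocForm (g u) (g v) (g w) = assocForm u v w) :
    (∀ u v : Fin 7 → ℝ, ∑ i, g u i * g v i = ∑ i, u i * v i) ∧
    LinearMap.det (g : (Fin 7 → ℝ) →ₗ[ℝ] (Fin 7 → ℝ)) = 1 := by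
  set d := LinearMap.det (g : (Fin 7 → ℝ) →ₗ[ℝ] (Fin 7 → ℝ)) with hd
  have key : ∀ u, d * ∑ i, g u i * g u i = ∑ i, u i * u i := by
    intro u
    have h1 : topU (g u) (fun i => g (Pi.single i 1)) = topU u (fun i => Pi.single i 1) := by
      simp only [topU, hg]
    have h2 : topU (g u) (fun i => g (Pi.single i 1)) =
        d * topU (g u) (fun i => Pi.single i 1) := by
      have h3 := (topA (g u)).eq_smul_basis_det (Pi.basisFun ℝ (Fin 7))
      have h4 := congrArg (fun f => f (fun i => g (Pi.single i 1))) h3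
      have h5 := (Pi.basisFun ℝ (Fin 7)).det_comp (g : (Fin 7 → ℝ) →ₗ[ℝ] (Fin 7 → ℝ))
        (Pi.basisFun ℝ (Fin 7))
      have h6 : (⇑(g : (Fin 7 → ℝ) →ₗ[ℝ] (Fin 7 → ℝ)) ∘ ⇑(Pi.basisFun ℝ (Fin 7))) =
        (fun i => g (Pi.single i 1)) := by ext1 i; simp
      have h7 : ⇑(Pi.basisFun ℝ (Fin 7)) = (fun i => Pi.single i 1) := by ext1 i; simp
      rw [h6, Module.Basis.det_self, mul_one] at h5
      simp only [AlternatingMap.smul_apply, smul_eq_mul, h5, h7] at h4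
      rw [mul_comm]
      exact h4
    rw [h1, topU_std, topU_std] at h2
    linarith
  have key2 : ∀ u v, d * ∑ i, g u i * g v i = ∑ i, u i * v i := by
    intro u v
    have a := key (u + v)
    have b := key u
    have c := key v
    simp only [map_add, Pi.add_apply, Fin.sum_univ_succ, Finset.univ_eq_empty,
      Finset.sum_empty] at a b c ⊢
    linarith
  have hd1 : d = 1 := by
    set G := LinearMap.toMatrix' (g : (Fin 7 → ℝ) →ₗ[ℝ] (Fin 7 → ℝ)) with hG
    have hm : d • (G.transpose * G) = 1 := by
      ext i j
      have := key2 (Pi.single i 1) (Pi.single j 1)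
      simp only [Matrix.smul_apply, Matrix.mul_apply, Matrix.transpose_apply, hG,
        LinearMap.toMatrix'_apply, smul_eq_mul]
      refine Eq.trans ?_ (this.trans ?_)
      · congr 1
      · simp [Matrix.one_apply, Pi.single_apply, eq_comm]
    have h := congrArg Matrix.det hm
    have hGd : G.det = d := by rw [hG, LinearMap.det_toMatrix']
    rw [Matrix.det_smul, Matrix.det_mul, Matrix.det_transpose, hGd, Matrix.det_one] at h
    simp only [Fintype.card_fin] at h
    have h9 : d ^ 9 = 1 ^ 9 := by rw [one_pow, ← h]; ring
    exact (Odd.strictMono_pow (by decide : Odd 9)).injective h9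
  refine ⟨fun u v => ?_, hd1⟩
  have := key2 u v
  rwa [hd1, one_mul] at this
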